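/- arXiv:1703.00567 — 11 statements merged into one kernel-verified Lean document; each statement's English description precedes it below -/
import Mathlib

section
/- Let h₁, h₂ ∈ L¹(Ω) with h₁(x) ≤ h₂(x) for a.e. x ∈ Ω, and let v₁ and v₂ be solutions of the problem −(φ(vᵢ′))′ = hᵢ in Ω, vᵢ = 0 on ∂Ω, for i = 1, 2 respectively. Then v₁(x) ≤ v₂(x) for all x ∈ [a,b]. -/
open MeasureTheory Set

/-- `v` is a solution of `-(φ(v'))' = h` in `Ω = (a,b)`, `v = 0` on `∂Ω`:
`v ∈ C¹([a,b])`, `v a = v b = 0`, and `φ ∘ v'` is absolutely continuous with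
`-(φ(v'))' = h` a.e., which (for `h ∈ L¹`) is equivalent to the integral
representation `φ (v' x) = φ (v' a) - ∫_a^x h`. -/
def IsSol (a b : ℝ) (φ h v v' : ℝ → ℝ) : Prop :=
  v a = 0 ∧ v b = 0 ∧
  ContinuousOn v' (Set.Icc a b) ∧
  (∀ x ∈ Set.Icc a b, HasDerivWithinAt v (v' x) (Set.Icc a b) x) ∧
  (∀ x ∈ Set.Icc a b, φ (v' x) = φ (v' a) - ∫ t in a..x, h t)

/-- the solution operator is nondecreasing. -/
theorem solution_comparison
    (a b : ℝ) (hab : a < b)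
    (φ : ℝ → ℝ) (hodd : ∀ x, φ (-x) = -φ x) (hmono : StrictMono φ)
    (hcont : Continuous φ) (hsurj : Function.Surjective φ)
    (h₁ h₂ : ℝ → ℝ)
    (hh₁ : IntegrableOn h₁ (Set.Ioo a b)) (hh₂ : IntegrableOn h₂ (Set.Ioo a b))
    (hle : ∀ᵐ x ∂(volume.restrict (Set.Ioo a b)), h₁ x ≤ h₂ x)
    (v₁ v₁' v₂ v₂' : ℝ → ℝ)
    (hv₁ : IsSol a b φ h₁ v₁ v₁') (hv₂ : IsSol a b φ h₂ v₂ v₂') :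
    ∀ x ∈ Set.Icc a b, v₁ x ≤ v₂ x := by
  obtain ⟨ha1, hb1, -, hd1, he1⟩ := hv₁
  obtain ⟨ha2, hb2, -, hd2, he2⟩ := hv₂
  intro c hc
  by_contra hcon
  have hcon : v₂ c < v₁ c := not_le.mp hcon
  have hac : a < c := by
    rcases hc.1.eq_or_lt with h | h
    · subst h; linarith
    · exact h
  have hcb : c < b := by
    rcases hc.2.eq_or_lt with h | h
    · subst h; linarith
    · exact h
  have hw : ∀ x ∈ Icc a b, HasDerivWithinAt (fun y => v₁ y - v₂ y) (v₁' x - v₂' x) (Icc a b) x :=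
    fun x hx => (hd1 x hx).sub (hd2 x hx)
  have hwc : ContinuousOn (fun y => v₁ y - v₂ y) (Icc a b) :=
    fun x hx => (hw x hx).continuousWithinAt
  have hwd : ∀ x ∈ Ioo a b, HasDerivAt (fun y => v₁ y - v₂ y) (v₁' x - v₂' x) x :=
    fun x hx => (hw x (Ioo_subset_Icc_self hx)).hasDerivAt (Icc_mem_nhds hx.1 hx.2)
  obtain ⟨ξ, hξ, hξe⟩ := exists_hasDerivAt_eq_slope (fun y => v₁ y - v₂ y)
    (fun x => v₁' x - v₂' x) hac (hwc.mono (Icc_subset_Icc_right hc.2))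
    (fun x hx => hwd x ⟨hx.1, hx.2.trans hcb⟩)
  obtain ⟨η, hη, hηe⟩ := exists_hasDerivAt_eq_slope (fun y => v₁ y - v₂ y)
    (fun x => v₁' x - v₂' x) hcb (hwc.mono (Icc_subset_Icc_left hc.1))
    (fun x hx => hwd x ⟨hac.trans hx.1, hx.2⟩)
  have hpos : 0 < v₁' ξ - v₂' ξ := by
    rw [hξe]; apply div_pos <;> linarith
  have hneg : v₁' η - v₂' η < 0 := by
    rw [hηe]; apply div_neg_of_neg_of_pos <;> linarith
  have h1 := hmono (sub_pos.mp hpos)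
  have h2 := hmono (sub_neg.mp hneg)
  have hξη : ξ ≤ η := (hξ.2.trans hη.1).le
  have haξ : a ≤ ξ := hξ.1.le
  have hηb : η ≤ b := hη.2.le
  have key : ∀ h : ℝ → ℝ, IntegrableOn h (Ioo a b) → ∀ x ∈ Icc a b, ∀ y ∈ Icc a b,
      IntervalIntegrable h volume x y := by
    intro h hh x hx y hy
    have h0 : IntervalIntegrable h volume a b :=
      (intervalIntegrable_iff_integrableOn_Ioo_of_le hab.le).2 hh
    apply h0.mono_set
    rw [uIcc_of_le hab.le]
    exact uIcc_subset_Icc hx hy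
  have mA : a ∈ Icc a b := ⟨le_rfl, hab.le⟩
  have mξ : ξ ∈ Icc a b := ⟨haξ, hξη.trans hηb⟩
  have mη : η ∈ Icc a b := ⟨haξ.trans hξη, hηb⟩
  have i1 := intervalIntegral.integral_add_adjacent_intervals
    (key h₁ hh₁ a mA ξ mξ) (key h₁ hh₁ ξ mξ η mη)
  have i2 := intervalIntegral.integral_add_adjacent_intervals
    (key h₂ hh₂ a mA ξ mξ) (key h₂ hh₂ ξ mξ η mη)
  have hint : ∫ t in ξ..η, h₁ t ≤ ∫ t in ξ..η, h₂ t := by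
    apply intervalIntegral.integral_mono_ae_restrict hξη
      (key h₁ hh₁ ξ mξ η mη) (key h₂ hh₂ ξ mξ η mη)
    have hsub : Icc ξ η ⊆ Ioo a b :=
      fun x hx => ⟨hξ.1.trans_le hx.1, hx.2.trans_lt hη.2⟩
    exact ae_restrict_of_ae_restrict_of_subset hsub hle
  rw [he1 ξ mξ, he2 ξ mξ] at h1
  rw [he1 η mη, he2 η mη] at h2
  linarith
end

section
/- Let h ∈ L¹(Ω) with h ≥ 0 a.e. and h ≢ 0, and let v be a solution of −(φ(v′))′ = h in Ω, v = 0 on ∂Ω. Then v(x) ≤ φ⁻¹(∫ₐᵇ h(t) dt) · δ_Ω(x) for all x ∈ [a,b]. -/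
open MeasureTheory Set

/-- upper bound `v ≤ φ⁻¹(∫_a^b h) δ_Ω` for `0 ≤ h ≢ 0`. -/
theorem upper_bound
    (a b : ℝ) (hab : a < b)
    (φ : ℝ → ℝ) (hodd : ∀ x, φ (-x) = -φ x) (hmono : StrictMono φ)
    (hcont : Continuous φ) (hsurj : Function.Surjective φ)
    (φinv : ℝ → ℝ) (hinv₁ : ∀ x, φinv (φ x) = x) (hinv₂ : ∀ x, φ (φinv x) = x)
    (h : ℝ → ℝ) (hh : IntegrableOn h (Set.Ioo a b))
    (hpos : ∀ᵐ x ∂(volume.restrict (Set.Ioo a b)), 0 ≤ h x)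
    (hne : ¬ (∀ᵐ x ∂(volume.restrict (Set.Ioo a b)), h x = 0))
    (v v' : ℝ → ℝ) (hv : IsSol a b φ h v v') :
    ∀ x ∈ Set.Icc a b, v x ≤ φinv (∫ t in a..b, h t) * min (x - a) (b - x) := by
  obtain ⟨hva, hvb, -, hder, heq⟩ := hv
  have hint : IntervalIntegrable h volume a b :=
    (intervalIntegrable_iff_integrableOn_Ioo_of_le hab.le).2 hh
  have hsub : ∀ x ∈ Set.Icc a b, ∀ y ∈ Set.Icc a b, IntervalIntegrable h volume x y := by
    intro x hx y hy
    apply hint.mono_set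
    rw [uIcc_of_le hab.le]
    exact Set.ordConnected_Icc.uIcc_subset hx hy
  have hnn : ∀ x ∈ Set.Icc a b, ∀ y ∈ Set.Icc a b, x ≤ y → 0 ≤ ∫ t in x..y, h t := by
    intro x hx y hy hxy
    rw [intervalIntegral.integral_of_le hxy, integral_Ioc_eq_integral_Ioo]
    apply integral_nonneg_of_ae
    exact ae_restrict_of_ae_restrict_of_subset (Set.Ioo_subset_Ioo hx.1 hy.2) hpos
  have ha : a ∈ Set.Icc a b := ⟨le_rfl, hab.le⟩
  have hb : b ∈ Set.Icc a b := ⟨hab.le, le_rfl⟩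
  have hbd : ∀ x ∈ Set.Icc a b, 0 ≤ (∫ t in a..x, h t) ∧
      (∫ t in a..x, h t) ≤ ∫ t in a..b, h t := by
    intro x hx
    refine ⟨hnn a ha x hx hx.1, ?_⟩
    have h1 := hnn x hx b hb hx.2
    have h2 := intervalIntegral.integral_add_adjacent_intervals (hsub a ha x hx) (hsub x hx b hb)
    linarith
  have h0 : φ 0 = 0 := by
    have := hodd 0
    rw [neg_zero] at this
    linarith
  obtain ⟨c, hc, hc0⟩ := exists_hasDerivAt_eq_zero (f := v) (f' := v') hab
    (fun x hx => (hder x hx).continuousWithinAt) (hva.trans hvb.symm)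
    (fun x hx => (hder x (Set.Ioo_subset_Icc_self hx)).hasDerivAt (Icc_mem_nhds hx.1 hx.2))
  have hcI := Set.Ioo_subset_Icc_self hc
  have hφc := heq c hcI
  rw [hc0, h0] at hφc
  have hbound : ∀ x ∈ Set.Icc a b, ‖v' x‖ ≤ φinv (∫ t in a..b, h t) := by
    intro x hx
    have e := heq x hx
    have b1 := hbd x hx
    have b2 := hbd c hcI
    rw [Real.norm_eq_abs, abs_le]
    constructor
    · rw [← hmono.le_iff_le, hodd, hinv₂]
      linarith
    · rw [← hmono.le_iff_le, hinv₂]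
      linarith
  intro x hx
  have k1 := (convex_Icc a b).norm_image_sub_le_of_norm_hasDerivWithin_le hder hbound ha hx
  have k2 := (convex_Icc a b).norm_image_sub_le_of_norm_hasDerivWithin_le hder hbound hb hx
  rw [Real.norm_eq_abs, Real.norm_eq_abs, hva, sub_zero, abs_of_nonneg (sub_nonneg.2 hx.1)] at k1
  rw [Real.norm_eq_abs, Real.norm_eq_abs, hvb, sub_zero, abs_of_nonpos (sub_nonpos.2 hx.2),
    neg_sub] at k2
  rcases min_choice (x - a) (b - x) with hm | hm <;> rw [hm]
  · exact (le_abs_self _).trans k1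
  · exact (le_abs_self _).trans k2
end

section
/- Let h ∈ L¹(Ω) with h ≥ 0 a.e. and h ≢ 0, and let v be a solution of −(φ(v′))′ = h in Ω, v = 0 on ∂Ω. Then for all x ∈ [a,b], v(x) ≥ θ̲_h · min{ ∫ₐ^{θ̄_h} φ⁻¹(∫_y^{θ̄_h} h) dy , ∫_{θ̄_h}^{b} φ⁻¹(∫_{θ̄_h}^{y} h) dy } · δ_Ω(x), and the constant multiplying δ_Ω is strictly positive. -/
open MeasureTheory Set

/-- `𝒜_h = {x ∈ Ω : h = 0 a.e. on (a,x)}`. -/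
def alphaSet (a b : ℝ) (h : ℝ → ℝ) : Set ℝ :=
  {x | x ∈ Set.Ioo a b ∧ ∀ᵐ y ∂(volume.restrict (Set.Ioo a x)), h y = 0}

/-- `ℬ_h = {x ∈ Ω : h = 0 a.e. on (x,b)}`. -/
def betaSet (a b : ℝ) (h : ℝ → ℝ) : Set ℝ :=
  {x | x ∈ Set.Ioo a b ∧ ∀ᵐ y ∂(volume.restrict (Set.Ioo x b)), h y = 0}

-- `α_h`
open Classical in
noncomputable def alphaH (a b : ℝ) (h : ℝ → ℝ) : ℝ :=
  if (alphaSet a b h).Nonempty then sSup (alphaSet a b h) else a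

-- `β_h`
open Classical in
noncomputable def betaH (a b : ℝ) (h : ℝ → ℝ) : ℝ :=
  if (betaSet a b h).Nonempty then sInf (betaSet a b h) else b

/-- `θ̲_h = min{1/(β_h - a), 1/(b - α_h)}`. -/
noncomputable def thetaLow (a b : ℝ) (h : ℝ → ℝ) : ℝ :=
  min (1 / (betaH a b h - a)) (1 / (b - alphaH a b h))

/-- `θ̄_h = (α_h + β_h)/2`. -/
noncomputable def thetaBar (a b : ℝ) (h : ℝ → ℝ) : ℝ :=
  (alphaH a b h + betaH a b h) / 2

/-- lower bound
`v ≥ θ̲_h · min{∫_a^{θ̄_h} φ⁻¹(∫_y^{θ̄_h} h) dy, ∫_{θ̄_h}^b φ⁻¹(∫_{θ̄_h}^y h) dy} · δ_Ω`,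
with a strictly positive constant. -/
theorem lower_bound
    (a b : ℝ) (hab : a < b)
    (φ : ℝ → ℝ) (hodd : ∀ x, φ (-x) = -φ x) (hmono : StrictMono φ)
    (hcont : Continuous φ) (hsurj : Function.Surjective φ)
    (φinv : ℝ → ℝ) (hinv₁ : ∀ x, φinv (φ x) = x) (hinv₂ : ∀ x, φ (φinv x) = x)
    (h : ℝ → ℝ) (hh : IntegrableOn h (Set.Ioo a b))
    (hpos : ∀ᵐ x ∂(volume.restrict (Set.Ioo a b)), 0 ≤ h x)
    (hne : ¬ (∀ᵐ x ∂(volume.restrict (Set.Ioo a b)), h x = 0))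
    (v v' : ℝ → ℝ) (hv : IsSol a b φ h v v') :
    0 < thetaLow a b h *
        min (∫ y in a..thetaBar a b h, φinv (∫ t in y..thetaBar a b h, h t))
          (∫ y in thetaBar a b h..b, φinv (∫ t in thetaBar a b h..y, h t)) ∧
    ∀ x ∈ Set.Icc a b,
      thetaLow a b h *
          min (∫ y in a..thetaBar a b h, φinv (∫ t in y..thetaBar a b h, h t))
            (∫ y in thetaBar a b h..b, φinv (∫ t in thetaBar a b h..y, h t)) *
          min (x - a) (b - x) ≤ v x := by
  obtain ⟨hva, hvb, hv'c, hvd, hveq⟩ := hv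
  have haI : a ∈ Icc a b := ⟨le_refl _, hab.le⟩
  have hbI : b ∈ Icc a b := ⟨hab.le, le_refl _⟩
  obtain ⟨F, hF⟩ : ∃ F : ℝ → ℝ, F = fun x => ∫ t in a..x, h t := ⟨_, rfl⟩
  have hii : ∀ x ∈ Icc a b, ∀ y ∈ Icc a b, IntervalIntegrable h volume x y := by
    have h0 : IntervalIntegrable h volume a b := by
      rw [intervalIntegrable_iff_integrableOn_Ioo_of_le hab.le]; exact hh
    intro x hx y hy
    apply h0.mono_set
    rw [uIcc_of_le hab.le]
    exact uIcc_subset_Icc hx hy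
  have hsub : ∀ x ∈ Icc a b, ∀ y ∈ Icc a b, ∫ t in x..y, h t = F y - F x := by
    intro x hx y hy
    rw [hF]
    exact (intervalIntegral.integral_interval_sub_left (hii a haI y hy) (hii a haI x hx)).symm
  have hFa : F a = 0 := by simp [hF]
  have hposI : ∀ x ∈ Icc a b, ∀ y ∈ Icc a b, ∀ᵐ t ∂(volume.restrict (Ioo x y)), 0 ≤ h t := by
    intro x hx y hy
    exact ae_restrict_of_ae_restrict_of_subset (Ioo_subset_Ioo hx.1 hy.2) hpos
  have hFset : ∀ x ∈ Icc a b, ∀ y ∈ Icc a b, x ≤ y → F y - F x = ∫ t in Ioo x y, h t := by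
    intro x hx y hy hxy
    rw [← hsub x hx y hy, intervalIntegral.integral_of_le hxy, integral_Ioc_eq_integral_Ioo]
  have hFm : ∀ x ∈ Icc a b, ∀ y ∈ Icc a b, x ≤ y → F x ≤ F y := by
    intro x hx y hy hxy
    have := hFset x hx y hy hxy
    have h2 : 0 ≤ ∫ t in Ioo x y, h t := integral_nonneg_of_ae (hposI x hx y hy)
    linarith
  have hFz : ∀ x ∈ Icc a b, ∀ y ∈ Icc a b, x ≤ y →
      (F x = F y ↔ ∀ᵐ t ∂(volume.restrict (Ioo x y)), h t = 0) := by
    intro x hx y hy hxy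
    have h1 := hFset x hx y hy hxy
    have h2 := setIntegral_eq_zero_iff_of_nonneg_ae (hposI x hx y hy)
      (hh.mono_set (Ioo_subset_Ioo hx.1 hy.2))
    constructor
    · intro e
      exact h2.1 (by linarith)
    · intro e
      have := h2.2 e
      linarith
  have hFc : ContinuousOn F (Icc a b) := by
    have := intervalIntegral.continuousOn_primitive_interval (f := h) (μ := volume) (a := a) (b := b)
      (by rw [uIcc_of_le hab.le, integrableOn_Icc_iff_integrableOn_Ioo]; exact hh)
    rw [uIcc_of_le hab.le] at this
    rw [hF]; exact this
  have hFb : F a < F b := by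
    refine lt_of_le_of_ne (hFm a haI b hbI hab.le) ?_
    intro e
    exact hne ((hFz a haI b hbI hab.le).1 e)
  -- alpha
  obtain ⟨hαI, hα0, hα1⟩ : alphaH a b h ∈ Icc a b ∧ F (alphaH a b h) = F a ∧
      ∀ x ∈ Ioo a b, alphaH a b h < x → F x ≠ F a := by
    have hcl : IsClosed (Icc a b ∩ F ⁻¹' {F a}) :=
      hFc.preimage_isClosed_of_isClosed isClosed_Icc isClosed_singleton
    have hss : alphaSet a b h ⊆ Icc a b ∩ F ⁻¹' {F a} := by
      rintro x ⟨hx, hx2⟩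
      exact ⟨Ioo_subset_Icc_self hx,
        ((hFz a haI x (Ioo_subset_Icc_self hx) hx.1.le).2 hx2).symm⟩
    have hbd : BddAbove (alphaSet a b h) := ⟨b, fun x hx => hx.1.2.le⟩
    have key : ∀ x ∈ Ioo a b, F x = F a → x ∈ alphaSet a b h := fun x hx e =>
      ⟨hx, (hFz a haI x (Ioo_subset_Icc_self hx) hx.1.le).1 e.symm⟩
    unfold alphaH
    split_ifs with hn
    · have := closure_minimal hss hcl (csSup_mem_closure hn hbd)
      refine ⟨this.1, this.2, fun x hx hlt e => ?_⟩
      exact absurd (le_csSup hbd (key x hx e)) (not_le.2 hlt)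
    · exact ⟨haI, rfl, fun x hx _ e => hn ⟨x, key x hx e⟩⟩
  obtain ⟨hβI, hβ0, hβ1⟩ : betaH a b h ∈ Icc a b ∧ F (betaH a b h) = F b ∧
      ∀ x ∈ Ioo a b, x < betaH a b h → F x ≠ F b := by
    have hcl : IsClosed (Icc a b ∩ F ⁻¹' {F b}) :=
      hFc.preimage_isClosed_of_isClosed isClosed_Icc isClosed_singleton
    have hss : betaSet a b h ⊆ Icc a b ∩ F ⁻¹' {F b} := by
      rintro x ⟨hx, hx2⟩
      exact ⟨Ioo_subset_Icc_self hx,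
        ((hFz x (Ioo_subset_Icc_self hx) b hbI hx.2.le).2 hx2)⟩
    have hbd : BddBelow (betaSet a b h) := ⟨a, fun x hx => hx.1.1.le⟩
    have key : ∀ x ∈ Ioo a b, F x = F b → x ∈ betaSet a b h := fun x hx e =>
      ⟨hx, (hFz x (Ioo_subset_Icc_self hx) b hbI hx.2.le).1 e⟩
    unfold betaH
    split_ifs with hn
    · have := closure_minimal hss hcl (csInf_mem_closure hn hbd)
      refine ⟨this.1, this.2, fun x hx hlt e => ?_⟩
      exact absurd (csInf_le hbd (key x hx e)) (not_le.2 hlt)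
    · exact ⟨hbI, rfl, fun x hx _ e => hn ⟨x, key x hx e⟩⟩
  have hαβ : alphaH a b h < betaH a b h := by
    by_contra! hc
    have := hFm _ hβI _ hαI hc
    linarith
  unfold thetaLow thetaBar
  generalize alphaH a b h = α at *
  generalize betaH a b h = β at *
  obtain ⟨θ, hθ⟩ : ∃ θ, θ = (α + β) / 2 := ⟨_, rfl⟩
  rw [← hθ]
  have hαθ : α < θ := by linarith
  have hθβ : θ < β := by linarith
  have haθ : a < θ := by linarith [hαI.1]
  have hθb : θ < b := by linarith [hβI.2]
  have hθI : θ ∈ Icc a b := ⟨haθ.le, hθb.le⟩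
  have hFθ1 : F a < F θ :=
    lt_of_le_of_ne (hFm a haI θ hθI haθ.le) (hα1 θ ⟨haθ, hθb⟩ hαθ).symm
  have hFθ2 : F θ < F b :=
    lt_of_le_of_ne (hFm θ hθI b hbI hθb.le) (hβ1 θ ⟨haθ, hθb⟩ hθβ)
  -- the inverse
  have hφ0 : φ 0 = 0 := by
    have := hodd 0
    rw [neg_zero] at this
    linarith
  have hi0 : φinv 0 = 0 := by
    have := hinv₁ 0
    rwa [hφ0] at this
  have him : StrictMono φinv := by
    intro x y hxy
    rw [← hmono.lt_iff_lt, hinv₂, hinv₂]; exact hxy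
  have hic : Continuous φinv := him.monotone.continuous_of_surjective (fun x => ⟨φ x, hinv₁ x⟩)
  have hodi : ∀ x, φinv (-x) = - φinv x := by
    intro x
    apply hmono.injective
    rw [hinv₂, hodd, hinv₂]
  have e1 : (∫ y in a..θ, φinv (∫ t in y..θ, h t)) = ∫ y in a..θ, φinv (F θ - F y) := by
    apply intervalIntegral.integral_congr
    intro y hy
    rw [uIcc_of_le haθ.le] at hy
    simp only
    rw [hsub y ⟨hy.1, hy.2.trans hθb.le⟩ θ hθI]
  have e2 : (∫ y in θ..b, φinv (∫ t in θ..y, h t)) = ∫ y in θ..b, φinv (F y - F θ) := by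
    apply intervalIntegral.integral_congr
    intro y hy
    rw [uIcc_of_le hθb.le] at hy
    simp only
    rw [hsub θ hθI y ⟨haθ.le.trans hy.1, hy.2⟩]
  rw [e1, e2]
  have hs1 : Icc a θ ⊆ Icc a b := Icc_subset_Icc le_rfl hθb.le
  have hs2 : Icc θ b ⊆ Icc a b := Icc_subset_Icc haθ.le le_rfl
  have c1 : ContinuousOn (fun y => φinv (F θ - F y)) (Icc a θ) :=
    hic.comp_continuousOn (continuousOn_const.sub (hFc.mono hs1))
  have c2 : ContinuousOn (fun y => φinv (F y - F θ)) (Icc θ b) :=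
    hic.comp_continuousOn ((hFc.mono hs2).sub continuousOn_const)
  have p1 : 0 < ∫ y in a..θ, φinv (F θ - F y) := by
    apply intervalIntegral.integral_pos haθ c1
    · intro y hy
      have := hFm y ⟨hy.1.le, hy.2.trans hθb.le⟩ θ hθI hy.2
      rw [← hi0]; exact him.monotone (by linarith)
    · refine ⟨a, ⟨le_rfl, haθ.le⟩, ?_⟩
      rw [← hi0]; exact him (by linarith)
  have p2 : 0 < ∫ y in θ..b, φinv (F y - F θ) := by
    apply intervalIntegral.integral_pos hθb c2
    · intro y hy
      have := hFm θ hθI y ⟨haθ.le.trans hy.1.le, hy.2⟩ hy.1.le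
      rw [← hi0]; exact him.monotone (by linarith)
    · refine ⟨b, ⟨hθb.le, le_rfl⟩, ?_⟩
      rw [← hi0]; exact him (by linarith)
  have hvc : ContinuousOn v (Icc a b) := fun x hx => (hvd x hx).continuousWithinAt
  have hvd' : ∀ x ∈ Ioo a b, HasDerivAt v (v' x) x := fun x hx =>
    (hvd x (Ioo_subset_Icc_self hx)).hasDerivAt (Icc_mem_nhds hx.1 hx.2)
  obtain ⟨m, hm, hm0⟩ := exists_hasDerivAt_eq_zero hab hvc (hva.trans hvb.symm) hvd'
  have hmI := Ioo_subset_Icc_self hm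
  have hv'eq : ∀ y ∈ Icc a b, v' y = φinv (F m - F y) := by
    intro y hy
    have h1 := hveq y hy
    have h2 := hveq m hmI
    rw [hm0, hφ0] at h2
    have h3 : φ (v' y) = F m - F y := by
      rw [hF]; simp only; linarith
    rw [← h3, hinv₁]
  -- FTC
  have f1 : ∫ y in a..θ, v' y = v θ := by
    rw [intervalIntegral.integral_eq_sub_of_hasDerivAt_of_le haθ.le (hvc.mono hs1)
      (fun x hx => hvd' x ⟨hx.1, hx.2.trans hθb⟩)
      ((hv'c.mono hs1).intervalIntegrable_of_Icc haθ.le), hva, sub_zero]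
  have f2 : ∫ y in θ..b, v' y = - v θ := by
    rw [intervalIntegral.integral_eq_sub_of_hasDerivAt_of_le hθb.le (hvc.mono hs2)
      (fun x hx => hvd' x ⟨haθ.trans hx.1, hx.2⟩)
      ((hv'c.mono hs2).intervalIntegrable_of_Icc hθb.le), hvb, zero_sub]
  have hM : min (∫ y in a..θ, φinv (F θ - F y)) (∫ y in θ..b, φinv (F y - F θ)) ≤ v θ := by
    rcases le_total θ m with hθm | hmθ
    · refine (min_le_left _ _).trans ?_
      rw [← f1]
      apply intervalIntegral.integral_mono_on haθ.le (c1.intervalIntegrable_of_Icc haθ.le)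
        ((hv'c.mono hs1).intervalIntegrable_of_Icc haθ.le)
      intro y hy
      rw [hv'eq y (hs1 hy)]
      have := hFm θ hθI m hmI hθm
      exact him.monotone (by linarith)
    · refine (min_le_right _ _).trans ?_
      have : v θ = ∫ y in θ..b, - v' y := by
        rw [intervalIntegral.integral_neg, f2, neg_neg]
      rw [this]
      apply intervalIntegral.integral_mono_on hθb.le (c2.intervalIntegrable_of_Icc hθb.le)
        ((hv'c.mono hs2).neg.intervalIntegrable_of_Icc hθb.le)
      intro y hy
      show _ ≤ - v' y
      rw [hv'eq y (hs2 hy), ← hodi]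
      have := hFm m hmI θ hθI hmθ
      exact him.monotone (by linarith)
  have hconc : ConcaveOn ℝ (Icc a b) v := by
    apply AntitoneOn.concaveOn_of_deriv (convex_Icc a b) hvc
    · rw [interior_Icc]
      exact fun x hx => (hvd' x hx).differentiableAt.differentiableWithinAt
    · rw [interior_Icc]
      intro x hx y hy hxy
      rw [(hvd' x hx).deriv, (hvd' y hy).deriv, hv'eq x (Ioo_subset_Icc_self hx),
        hv'eq y (Ioo_subset_Icc_self hy)]
      have := hFm x (Ioo_subset_Icc_self hx) y (Ioo_subset_Icc_self hy) hxy
      exact him.monotone (by linarith)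
  have hMpos := lt_min p1 p2
  generalize min (∫ y in a..θ, φinv (F θ - F y)) (∫ y in θ..b, φinv (F y - F θ)) = M at *
  have hβa : 0 < β - a := by linarith
  have hbα : 0 < b - α := by linarith
  have hL : 0 < min (1 / (β - a)) (1 / (b - α)) := lt_min (by positivity) (by positivity)
  have hL1 : min (1 / (β - a)) (1 / (b - α)) ≤ 1 / (θ - a) :=
    (min_le_left _ _).trans (one_div_le_one_div_of_le (by linarith) (by linarith))
  have hL2 : min (1 / (β - a)) (1 / (b - α)) ≤ 1 / (b - θ) :=
    (min_le_right _ _).trans (one_div_le_one_div_of_le (by linarith) (by linarith))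
  generalize min (1 / (β - a)) (1 / (b - α)) = L at *
  refine ⟨by positivity, fun x hx => ?_⟩
  have hLM : 0 < L * M := by positivity
  rcases le_total x θ with hxθ | hθx
  · have hk : 0 < θ - a := by linarith
    have hxa : 0 ≤ x - a := by linarith [hx.1]
    have hcx := hconc.2 haI hθI
      (show 0 ≤ (θ - x) / (θ - a) from div_nonneg (by linarith) hk.le) (show 0 ≤ (x - a) / (θ - a) from div_nonneg hxa hk.le)
      (by field_simp; ring)
    have hpt : ((θ - x) / (θ - a)) • a + ((x - a) / (θ - a)) • θ = x := by
      simp only [smul_eq_mul]; field_simp; ring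
    rw [hpt, hva] at hcx
    simp only [smul_eq_mul, mul_zero, zero_add] at hcx
    calc L * M * min (x - a) (b - x) ≤ L * M * (x - a) :=
          mul_le_mul_of_nonneg_left (min_le_left _ _) hLM.le
      _ ≤ (1 / (θ - a)) * v θ * (x - a) := by gcongr
      _ = (x - a) / (θ - a) * v θ := by ring
      _ ≤ v x := hcx
  · have hk : 0 < b - θ := by linarith
    have hxb : 0 ≤ b - x := by linarith [hx.2]
    have hcx := hconc.2 hθI hbI
      (show 0 ≤ (b - x) / (b - θ) from div_nonneg hxb hk.le) (show 0 ≤ (x - θ) / (b - θ) from div_nonneg (by linarith) hk.le)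
      (by field_simp; ring)
    have hpt : ((b - x) / (b - θ)) • θ + ((x - θ) / (b - θ)) • b = x := by
      simp only [smul_eq_mul]; field_simp; ring
    rw [hpt, hvb] at hcx
    simp only [smul_eq_mul, mul_zero, add_zero] at hcx
    calc L * M * min (x - a) (b - x) ≤ L * M * (b - x) :=
          mul_le_mul_of_nonneg_left (min_le_right _ _) hLM.le
      _ ≤ (1 / (b - θ)) * v θ * (b - x) := by gcongr
      _ = (b - x) / (b - θ) * v θ := by ring
      _ ≤ v x := hcx
end

section
/- Let h ∈ L¹(Ω) with h ≥ 0 a.e. and h ≢ 0, and let v be a solution of −(φ(v′))′ = h in Ω, v = 0 on ∂Ω, written as v(x) = ∫ₐˣ φ⁻¹(c_h − ∫ₐʸ h(t) dt) dy, where c_h is the unique constant making v(b) = 0. Then 0 < c_h < ∫ₐᵇ h(t) dt, and consequently v′(b) < 0 < v′(a). -/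
open MeasureTheory Set

/-- for `0 ≤ h ≢ 0`, if `v(x) = ∫_a^x φ⁻¹(c_h - ∫_a^y h)dy` with
`v(b) = 0`, then `0 < c_h < ∫_a^b h` and consequently `v'(b) < 0 < v'(a)`. -/
theorem constant_bounds
    (a b : ℝ) (hab : a < b)
    (φ : ℝ → ℝ) (hodd : ∀ x, φ (-x) = -φ x) (hmono : StrictMono φ)
    (hcont : Continuous φ) (hsurj : Function.Surjective φ)
    (φinv : ℝ → ℝ) (hinv₁ : ∀ x, φinv (φ x) = x) (hinv₂ : ∀ x, φ (φinv x) = x)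
    (h : ℝ → ℝ) (hh : IntegrableOn h (Set.Ioo a b))
    (hpos : ∀ᵐ x ∂(volume.restrict (Set.Ioo a b)), 0 ≤ h x)
    (hne : ¬ (∀ᵐ x ∂(volume.restrict (Set.Ioo a b)), h x = 0))
    (c : ℝ) (v v' : ℝ → ℝ)
    (hv : ∀ x ∈ Set.Icc a b, v x = ∫ y in a..x, φinv (c - ∫ t in a..y, h t))
    (hv' : ∀ x ∈ Set.Icc a b, v' x = φinv (c - ∫ t in a..x, h t))
    (hvb : v b = 0) :
    (0 < c ∧ c < ∫ t in a..b, h t) ∧ v' b < 0 ∧ 0 < v' a := by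
  have hφ0 : φ 0 = 0 := by
    have := hodd 0
    simp only [neg_zero] at this
    linarith
  have hi0 : φinv 0 = 0 := by
    have := hinv₁ 0
    rwa [hφ0] at this
  have himono : StrictMono φinv := by
    intro x y hxy
    rw [← hmono.lt_iff_lt, hinv₂, hinv₂]
    exact hxy
  have hisurj : Function.Surjective φinv := fun x => ⟨φ x, hinv₁ x⟩
  have hicont : Continuous φinv := himono.monotone.continuous_of_surjective hisurj
  have hint : IntegrableOn h (Set.Icc a b) := by
    rwa [integrableOn_Icc_iff_integrableOn_Ioo]
  have hH : ContinuousOn (fun y => ∫ t in a..y, h t) (Set.Icc a b) := by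
    have := intervalIntegral.continuousOn_primitive_interval (μ := volume) (f := h)
      (a := a) (b := b) (by rwa [Set.uIcc_of_le hab.le])
    rwa [Set.uIcc_of_le hab.le] at this
  have hg : ContinuousOn (fun y => φinv (c - ∫ t in a..y, h t)) (Set.Icc a b) :=
    hicont.comp_continuousOn (continuousOn_const.sub hH)
  have hpos' : ∀ᵐ x ∂(volume.restrict (Set.Ioc a b)), 0 ≤ h x := by
    rwa [← restrict_Ioo_eq_restrict_Ioc]
  have hii : IntervalIntegrable h volume a b := by
    rw [intervalIntegrable_iff_integrableOn_Ioo_of_le hab.le]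
    exact hh
  have hle : ∀ y ∈ Set.Icc a b, 0 ≤ ∫ t in a..y, h t := by
    intro y hy
    rw [intervalIntegral.integral_of_le hy.1]
    exact integral_nonneg_of_ae
      (ae_restrict_of_ae_restrict_of_subset (Set.Ioc_subset_Ioc_right hy.2) hpos')
  have hle' : ∀ y ∈ Set.Icc a b, ∫ t in a..y, h t ≤ ∫ t in a..b, h t := by
    intro y hy
    rw [intervalIntegral.integral_of_le hy.1, intervalIntegral.integral_of_le hab.le]
    exact setIntegral_mono_set (hint.mono_set Set.Ioc_subset_Icc_self) hpos'
      (Set.Ioc_subset_Ioc_right hy.2).eventuallyLE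
  have hHb : 0 < ∫ t in a..b, h t := by
    refine lt_of_le_of_ne (hle b ⟨hab.le, le_rfl⟩) fun h0 => hne ?_
    rw [intervalIntegral.integral_of_le hab.le, ← restrict_Ioo_eq_restrict_Ioc] at h0
    exact (integral_eq_zero_iff_of_nonneg_ae hpos hh).mp h0.symm
  have hz : ∫ y in a..b, φinv (c - ∫ t in a..y, h t) = 0 := by
    rw [← hv b ⟨hab.le, le_rfl⟩, hvb]
  have hc0 : 0 < c := by
    by_contra hc
    push Not at hc
    have := intervalIntegral.integral_pos hab hg.neg
      (fun x hx => by
        have h1 := hle x ⟨hx.1.le, hx.2⟩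
        have h2 := himono.monotone (show c - ∫ t in a..x, h t ≤ 0 by linarith)
        rw [hi0] at h2
        simpa using h2)
      ⟨b, ⟨hab.le, le_rfl⟩, by
        have h2 := himono (show c - ∫ t in a..b, h t < 0 by linarith)
        rw [hi0] at h2
        simpa using h2⟩
    simp only [Pi.neg_apply, intervalIntegral.integral_neg, hz] at this
    simp at this
  have hcb : c < ∫ t in a..b, h t := by
    by_contra hc
    push Not at hc
    have := intervalIntegral.integral_pos hab hg
      (fun x hx => by
        have h1 := hle' x ⟨hx.1.le, hx.2⟩
        have h2 := himono.monotone (show 0 ≤ c - ∫ t in a..x, h t by linarith)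
        rwa [hi0] at h2)
      ⟨a, ⟨le_rfl, hab.le⟩, by
        have h2 := himono (show 0 < c - ∫ t in a..a, h t by simpa using hc0)
        rwa [hi0] at h2⟩
    exact this.ne' hz
  refine ⟨⟨hc0, hcb⟩, ?_, ?_⟩
  · rw [hv' b ⟨hab.le, le_rfl⟩, ← hi0]
    exact himono (by linarith)
  · rw [hv' a ⟨le_rfl, hab.le⟩, ← hi0]
    exact himono (by simpa using hc0)
end

section
/- Let h ∈ L¹(Ω) with h ≥ 0 a.e. and h ≢ 0, and let v be a solution of −(φ(v′))′ = h in Ω, v = 0 on ∂Ω. Then v is concave on [a,b] and v(x) ≥ θ̲_h · ‖v‖_∞ · δ_Ω(x) for all x ∈ [a,b]. -/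
open MeasureTheory Set

/-- `v` is concave on `[a,b]` and `v ≥ θ̲_h ‖v‖_∞ δ_Ω` there. -/
theorem concavity_and_lower_bound
    (a b : ℝ) (hab : a < b)
    (φ : ℝ → ℝ) (hodd : ∀ x, φ (-x) = -φ x) (hmono : StrictMono φ)
    (hcont : Continuous φ) (hsurj : Function.Surjective φ)
    (h : ℝ → ℝ) (hh : IntegrableOn h (Set.Ioo a b))
    (hpos : ∀ᵐ x ∂(volume.restrict (Set.Ioo a b)), 0 ≤ h x)
    (hne : ¬ (∀ᵐ x ∂(volume.restrict (Set.Ioo a b)), h x = 0))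
    (v v' : ℝ → ℝ) (hv : IsSol a b φ h v v') :
    ConcaveOn ℝ (Set.Icc a b) v ∧
    ∀ x ∈ Set.Icc a b,
      thetaLow a b h * sSup ((fun y => |v y|) '' Set.Icc a b) * min (x - a) (b - x)
        ≤ v x := by
  obtain ⟨hva, hvb, hv'c, hd, hphi⟩ := hv
  have haI : a ∈ Icc a b := ⟨le_rfl, hab.le⟩
  have hbI : b ∈ Icc a b := ⟨hab.le, le_rfl⟩
  have hIoc : IntegrableOn h (Ioc a b) := by
    rwa [integrableOn_Ioc_iff_integrableOn_Ioo]
  have hres : volume.restrict (Ioc a b) = volume.restrict (Ioo a b) :=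
    (Measure.restrict_congr_set Ioo_ae_eq_Ioc).symm
  have hposc : ∀ᵐ x ∂(volume.restrict (Ioc a b)), 0 ≤ h x := by rw [hres]; exact hpos
  -- monotonicity of the derivative
  have hanti : AntitoneOn v' (Icc a b) := by
    intro x hx y hy hxy
    rw [← hmono.le_iff_le, hphi x hx, hphi y hy,
      intervalIntegral.integral_of_le hx.1, intervalIntegral.integral_of_le hy.1]
    have hsub : Ioc a y ⊆ Ioc a b := Ioc_subset_Ioc_right hy.2
    have := setIntegral_mono_set (μ := volume) (f := h) (s := Ioc a x) (t := Ioc a y)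
      (hIoc.mono_set hsub) (ae_restrict_of_ae_restrict_of_subset hsub hposc)
      (Filter.Eventually.of_forall (Ioc_subset_Ioc_right hxy))
    linarith
  have hvc : ContinuousOn v (Icc a b) := fun x hx => (hd x hx).continuousWithinAt
  have hda : ∀ x ∈ Ioo a b, HasDerivAt v (v' x) x := fun x hx =>
    (hd x (Ioo_subset_Icc_self hx)).hasDerivAt (Icc_mem_nhds hx.1 hx.2)
  have hmvt : ∀ p ∈ Icc a b, ∀ q ∈ Icc a b, p < q →
      ∃ ξ ∈ Ioo p q, v' ξ * (q - p) = v q - v p := by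
    intro p hp q hq hpq
    obtain ⟨ξ, hξ, he⟩ := exists_hasDerivAt_eq_slope v v' hpq
      (hvc.mono (Icc_subset_Icc hp.1 hq.2))
      (fun x hx => hda x ⟨hp.1.trans_lt hx.1, hx.2.trans_le hq.2⟩)
    refine ⟨ξ, hξ, ?_⟩
    rw [he]
    have : q - p ≠ 0 := by linarith
    field_simp
  have hconc : ConcaveOn ℝ (Icc a b) v := by
    apply AntitoneOn.concaveOn_of_deriv (convex_Icc a b) hvc
    · rw [interior_Icc]
      exact fun x hx => (hda x hx).differentiableAt.differentiableWithinAt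
    · rw [interior_Icc]
      intro x hx y hy hxy
      rw [(hda x hx).deriv, (hda y hy).deriv]
      exact hanti (Ioo_subset_Icc_self hx) (Ioo_subset_Icc_self hy) hxy
  refine ⟨hconc, ?_⟩
  have hchord : ∀ p ∈ Icc a b, ∀ q ∈ Icc a b, p < q → ∀ x ∈ Icc p q,
      (q - x) * v p + (x - p) * v q ≤ (q - p) * v x := by
    intro p hp q hq hpq x hx
    have hqp : 0 < q - p := by linarith
    have h2 := hconc.2 hp hq
      (show 0 ≤ (q - x) / (q - p) from div_nonneg (by linarith [hx.2]) hqp.le)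
      (show 0 ≤ (x - p) / (q - p) from div_nonneg (by linarith [hx.1]) hqp.le)
      (by field_simp; ring)
    simp only [smul_eq_mul] at h2
    have e : (q - x) / (q - p) * p + (x - p) / (q - p) * q = x := by
      field_simp; ring
    rw [e] at h2
    have h3 := mul_le_mul_of_nonneg_left h2 hqp.le
    have e2 : (q - p) * ((q - x) / (q - p) * v p + (x - p) / (q - p) * v q)
      = (q - x) * v p + (x - p) * v q := by field_simp
    linarith
  have hnn : ∀ x ∈ Icc a b, 0 ≤ v x := by
    intro x hx
    have := hchord a haI b hbI hab x hx
    rw [hva, hvb] at this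
    have hba : 0 < b - a := by linarith
    nlinarith
  -- `v` is not identically zero
  have hnz : ¬ ∀ x ∈ Icc a b, v x ≤ 0 := by
    intro hz
    have hz' : ∀ x ∈ Icc a b, v x = 0 := fun x hx => le_antisymm (hz x hx) (hnn x hx)
    have hd0 : ∀ x ∈ Icc a b, v' x = 0 := by
      intro x hx
      have h1 : HasDerivWithinAt v 0 (Icc a b) x :=
        (hasDerivWithinAt_const x (Icc a b) (0:ℝ)).congr hz' (hz' x hx)
      exact (uniqueDiffOn_Icc hab x hx).eq_deriv _ (hd x hx) h1
    have h1 := hphi b hbI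
    rw [hd0 a haI, hd0 b hbI, intervalIntegral.integral_of_le hab.le] at h1
    have h2 : ∫ t in Ioc a b, h t = 0 := by linarith
    rw [hres] at h2
    apply hne
    exact (integral_eq_zero_iff_of_nonneg_ae hpos hh).1 h2
  have hpa : 0 < v' a := by
    by_contra hc
    push Not at hc
    apply hnz
    intro x hx
    rcases hx.1.eq_or_lt with rfl | hax
    · exact hva.le
    obtain ⟨ξ, hξ, he⟩ := hmvt a haI x hx hax
    have := hanti haI ⟨hξ.1.le, hξ.2.le.trans hx.2⟩ hξ.1.le
    nlinarith
  have hpb : v' b < 0 := by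
    by_contra hc
    push Not at hc
    apply hnz
    intro x hx
    rcases hx.2.eq_or_lt with rfl | hxb
    · exact hvb.le
    obtain ⟨ξ, hξ, he⟩ := hmvt x hx b hbI hxb
    have := hanti ⟨hx.1.trans hξ.1.le, hξ.2.le⟩ hbI hξ.2.le
    nlinarith
  obtain ⟨m, hm, hmax⟩ := isCompact_Icc.exists_isMaxOn ⟨a, haI⟩ hvc
  have hmax' : ∀ x ∈ Icc a b, v x ≤ v m := fun x hx => hmax hx
  have hsup : sSup ((fun y => |v y|) '' Icc a b) = v m := by
    apply IsGreatest.csSup_eq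
    refine ⟨⟨m, hm, abs_of_nonneg (hnn m hm)⟩, ?_⟩
    rintro _ ⟨y, hy, rfl⟩
    simp only [abs_of_nonneg (hnn y hy)]
    exact hmax' y hy
  have hMpos : 0 < v m := by
    by_contra hc
    exact hnz fun x hx => (hmax' x hx).trans (not_lt.1 hc)
  have ham : a < m := lt_of_le_of_ne hm.1 (by rintro rfl; linarith)
  have hmb : m < b := lt_of_le_of_ne hm.2 (by rintro rfl; linarith)
  have hal : alphaH a b h ≤ m := by
    unfold alphaH
    split_ifs with hA
    · apply csSup_le hA
      rintro x ⟨hx, hx0⟩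
      by_contra hc
      push Not at hc
      have hxI := Ioo_subset_Icc_self hx
      have hi : ∫ t in a..x, h t = 0 := by
        rw [intervalIntegral.integral_of_le hx.1.le, integral_Ioc_eq_integral_Ioo]
        exact integral_eq_zero_of_ae hx0
      have he : v' x = v' a := by
        apply hmono.injective
        rw [hphi x hxI, hi, sub_zero]
      obtain ⟨ξ, hξ, hs⟩ := hmvt m hm x hxI hc
      have := hanti ⟨ham.le.trans hξ.1.le, hξ.2.le.trans hx.2.le⟩ hxI hξ.2.le
      have := hmax' x hxI
      nlinarith
    · exact ham.le
  have hbe : m ≤ betaH a b h := by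
    unfold betaH
    split_ifs with hB
    · apply le_csInf hB
      rintro x ⟨hx, hx0⟩
      by_contra hc
      push Not at hc
      have hxI := Ioo_subset_Icc_self hx
      have hi : ∫ t in x..b, h t = 0 := by
        rw [intervalIntegral.integral_of_le hx.2.le, integral_Ioc_eq_integral_Ioo]
        exact integral_eq_zero_of_ae hx0
      have hadd : (∫ t in a..x, h t) + ∫ t in x..b, h t = ∫ t in a..b, h t := by
        apply intervalIntegral.integral_add_adjacent_intervals
        · rw [intervalIntegrable_iff_integrableOn_Ioc_of_le hx.1.le]
          exact hIoc.mono_set (Ioc_subset_Ioc_right hx.2.le)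
        · rw [intervalIntegrable_iff_integrableOn_Ioc_of_le hx.2.le]
          exact hIoc.mono_set (Ioc_subset_Ioc_left hx.1.le)
      have he : v' x = v' b := by
        apply hmono.injective
        rw [hphi x hxI, hphi b hbI, ← hadd, hi, add_zero]
      obtain ⟨ξ, hξ, hs⟩ := hmvt x hxI m hm hc
      have := hanti hxI ⟨hx.1.le.trans hξ.1.le, hξ.2.le.trans hmb.le⟩ hξ.1.le
      have := hmax' x hxI
      nlinarith
    · exact hmb.le
  intro x hx
  rw [hsup]
  have hmin0 : 0 ≤ min (x - a) (b - x) :=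
    le_min (by linarith [hx.1]) (by linarith [hx.2])
  rcases le_total x m with hxm | hmx
  · have hma : 0 < m - a := by linarith
    have ht : thetaLow a b h ≤ 1 / (m - a) :=
      (min_le_left _ _).trans (one_div_le_one_div_of_le hma (by linarith))
    have hch := hchord a haI m hm ham x ⟨hx.1, hxm⟩
    rw [hva] at hch
    calc thetaLow a b h * v m * min (x - a) (b - x)
        ≤ 1 / (m - a) * v m * (x - a) := by
          gcongr
          exact min_le_left _ _
      _ = ((x - a) * v m) / (m - a) := by ring
      _ ≤ v x := by rw [div_le_iff₀ hma]; linarith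
  · have hma : 0 < b - m := by linarith
    have ht : thetaLow a b h ≤ 1 / (b - m) :=
      (min_le_right _ _).trans (one_div_le_one_div_of_le hma (by linarith))
    have hch := hchord m hm b hbI hmb x ⟨hmx, hx.2⟩
    rw [hvb] at hch
    calc thetaLow a b h * v m * min (x - a) (b - x)
        ≤ 1 / (b - m) * v m * (b - x) := by
          gcongr
          exact min_le_right _ _
      _ = ((b - x) * v m) / (b - m) := by ring
      _ ≤ v x := by rw [div_le_iff₀ hma]; linarith
end

section
/- Let φ : ℝ → ℝ be an odd increasing homeomorphism and p > 0 such that liminf_{t→0⁺} t^p/φ(t) > 0 and liminf_{x→0⁺} φ(x)/x^p > 0. Then for every c_Ω > 0 there exists M > 0 such that φ(tx) ≤ M φ(t) φ(x) for all t ∈ [0,1] and all x ∈ [0,c_Ω]; in particular φ satisfies hypothesis H2. -/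
open Set Filter

/-- Remark tre (ii). If `liminf_{t→0⁺} t^p/φ(t) > 0` and
`liminf_{x→0⁺} φ(x)/x^p > 0` (rendered via their eventual-lower-bound
characterizations), then for every `c_Ω > 0` there is `M > 0` with
`φ(tx) ≤ M φ(t) φ(x)` for all `t ∈ [0,1]`, `x ∈ [0,c_Ω]`; i.e. H2 holds. -/
theorem H2_from_power_bounds
    (φ : ℝ → ℝ) (hodd : ∀ x, φ (-x) = -φ x) (hmono : StrictMono φ)
    (hcont : Continuous φ) (hsurj : Function.Surjective φ)
    (p : ℝ) (hp : 0 < p)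
    (h1 : ∃ ε > (0:ℝ), ∀ᶠ t in nhdsWithin 0 (Set.Ioi 0), ε ≤ t ^ p / φ t)
    (h2 : ∃ ε > (0:ℝ), ∀ᶠ x in nhdsWithin 0 (Set.Ioi 0), ε ≤ φ x / x ^ p) :
    ∀ cΩ > (0:ℝ), ∃ M > (0:ℝ),
      ∀ t ∈ Set.Icc (0:ℝ) 1, ∀ x ∈ Set.Icc (0:ℝ) cΩ,
        φ (t * x) ≤ M * φ t * φ x := by
  intro c hc
  have h0 : φ 0 = 0 := by
    have := hodd 0
    rw [neg_zero] at this
    linarith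
  have hpos : ∀ s, 0 < s → 0 < φ s := fun s hs => by
    have := hmono hs
    linarith
  obtain ⟨R, hR, hR1, hRc⟩ : ∃ R : ℝ, 0 < R ∧ 1 ≤ R ∧ c ≤ R :=
    ⟨max 1 c, by positivity, le_max_left _ _, le_max_right _ _⟩
  have hup : ∃ A > (0:ℝ), ∀ s, 0 < s → s ≤ R → φ s ≤ A * s ^ p := by
    obtain ⟨ε, hε, h⟩ := h1
    obtain ⟨δ, hδ, h⟩ := mem_nhdsGT_iff_exists_Ioo_subset.1 h
    have hδ : 0 < δ := hδ
    have hRp := hpos R hR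
    have hδp : 0 < δ ^ p := Real.rpow_pos_of_pos hδ p
    refine ⟨1 / ε + φ R / δ ^ p, by positivity, fun s hs hsR => ?_⟩
    have hsp : 0 < s ^ p := Real.rpow_pos_of_pos hs p
    rw [add_mul]
    rcases lt_or_ge s δ with hsd | hsd
    · have h3 : ε ≤ s ^ p / φ s := h ⟨hs, hsd⟩
      rw [le_div_iff₀ (hpos s hs)] at h3
      have h4 : φ s ≤ 1 / ε * s ^ p := by
        rw [one_div_mul_eq_div, le_div_iff₀ hε]
        linarith
      have : 0 < φ R / δ ^ p * s ^ p := by positivity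
      linarith
    · have h3 : φ s ≤ φ R := hmono.monotone hsR
      have h4 : δ ^ p ≤ s ^ p := Real.rpow_le_rpow hδ.le hsd hp.le
      have h5 : φ R ≤ φ R / δ ^ p * s ^ p := by
        rw [div_mul_eq_mul_div, le_div_iff₀ hδp]
        exact mul_le_mul_of_nonneg_left h4 hRp.le
      have : 0 < 1 / ε * s ^ p := by positivity
      linarith
  have hlow : ∃ a > (0:ℝ), ∀ s, 0 < s → s ≤ R → a * s ^ p ≤ φ s := by
    obtain ⟨ε, hε, h⟩ := h2
    obtain ⟨δ, hδ, h⟩ := mem_nhdsGT_iff_exists_Ioo_subset.1 h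
    have hδ : 0 < δ := hδ
    have hφδ := hpos δ hδ
    have hRp : 0 < R ^ p := Real.rpow_pos_of_pos hR p
    refine ⟨min ε (φ δ / R ^ p), by positivity, fun s hs hsR => ?_⟩
    have hsp : 0 < s ^ p := Real.rpow_pos_of_pos hs p
    rcases lt_or_ge s δ with hsd | hsd
    · have h3 : ε ≤ φ s / s ^ p := h ⟨hs, hsd⟩
      rw [le_div_iff₀ hsp] at h3
      exact (mul_le_mul_of_nonneg_right (min_le_left _ _) hsp.le).trans h3
    · have h3 : φ δ ≤ φ s := hmono.monotone hsd
      have h4 : s ^ p ≤ R ^ p := Real.rpow_le_rpow hs.le hsR hp.le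
      refine (mul_le_mul_of_nonneg_right (min_le_right _ _) hsp.le).trans (le_trans ?_ h3)
      rw [div_mul_eq_mul_div, div_le_iff₀ hRp]
      exact mul_le_mul_of_nonneg_left h4 hφδ.le
  obtain ⟨A, hA, hup⟩ := hup
  obtain ⟨a, ha, hlow⟩ := hlow
  refine ⟨A / (a * a), by positivity, ?_⟩
  rintro t ⟨ht0, ht1⟩ x ⟨hx0, hxc⟩
  rcases ht0.eq_or_lt with rfl | ht
  · simp [h0]
  rcases hx0.eq_or_lt with rfl | hx
  · simp [h0]
  have htp : 0 < t ^ p := Real.rpow_pos_of_pos ht p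
  have hxp : 0 < x ^ p := Real.rpow_pos_of_pos hx p
  have htx : t * x ≤ R := by nlinarith
  have e1 := hup (t * x) (mul_pos ht hx) htx
  rw [Real.mul_rpow ht.le hx.le] at e1
  have e2 : (a * t ^ p) * (a * x ^ p) ≤ φ t * φ x :=
    mul_le_mul (hlow t ht (ht1.trans hR1)) (hlow x hx (hxc.trans hRc))
      (by positivity) (hpos t ht).le
  calc φ (t * x) ≤ A * (t ^ p * x ^ p) := e1
    _ = A / (a * a) * ((a * t ^ p) * (a * x ^ p)) := by field_simp
    _ ≤ A / (a * a) * (φ t * φ x) := mul_le_mul_of_nonneg_left e2 (by positivity)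
    _ = A / (a * a) * φ t * φ x := by ring
end

section
/- Let φ : ℝ → ℝ be an odd increasing homeomorphism that is differentiable on (0,c_Ω), and suppose M := sup{ t φ′(tx) / (φ(t) φ′(x)) : t ∈ (0,1), x ∈ (0,c_Ω) } < ∞. Then φ(tx) ≤ M φ(t) φ(x) for all t ∈ [0,1] and x ∈ [0,c_Ω], i.e. hypothesis H2 holds with t₂ = 1. -/
open Set Filter

/-- Remark tre (iii). If `φ` is differentiable on `(0,c_Ω)` and
`M` bounds `t φ'(tx)/(φ(t) φ'(x))` over `t ∈ (0,1)`, `x ∈ (0,c_Ω)`, then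
`φ(tx) ≤ M φ(t) φ(x)` for all `t ∈ [0,1]`, `x ∈ [0,c_Ω]`; i.e. H2 holds with
`t₂ = 1`. -/
theorem H2_from_derivative_bound
    (φ : ℝ → ℝ) (hodd : ∀ x, φ (-x) = -φ x) (hmono : StrictMono φ)
    (hcont : Continuous φ) (hsurj : Function.Surjective φ)
    (cΩ : ℝ) (hcΩ : 0 < cΩ)
    (φ' : ℝ → ℝ) (hdiff : ∀ x ∈ Set.Ioo (0:ℝ) cΩ, HasDerivAt φ (φ' x) x)
    (M : ℝ)
    (hbound : ∀ t ∈ Set.Ioo (0:ℝ) 1, ∀ x ∈ Set.Ioo (0:ℝ) cΩ,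
      t * φ' (t * x) / (φ t * φ' x) ≤ M) :
    ∀ t ∈ Set.Icc (0:ℝ) 1, ∀ x ∈ Set.Icc (0:ℝ) cΩ,
      φ (t * x) ≤ M * φ t * φ x := by
  have h0 : φ 0 = 0 := by
    have := hodd 0
    rw [neg_zero] at this
    linarith
  have hpos : ∀ s, 0 < s → 0 < φ s := fun s hs => by
    have := hmono hs
    rwa [h0] at this
  have hnn : ∀ x ∈ Set.Ioo (0:ℝ) cΩ, 0 ≤ φ' x := fun x hx => by
    rw [← (hdiff x hx).deriv]
    exact hmono.monotone.deriv_nonneg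
  -- the derivative is positive everywhere (Darboux argument)
  have hd : ∀ x ∈ Set.Ioo (0:ℝ) cΩ, 0 < φ' x := by
    intro x hx
    by_contra hcon
    have hx0 : φ' x = 0 := le_antisymm (not_lt.mp hcon) (hnn x hx)
    obtain ⟨y, hy, hyd⟩ := exists_hasDerivAt_eq_slope φ φ' hx.1 hcont.continuousOn
      (fun z hz => hdiff z ⟨hz.1, hz.2.trans hx.2⟩)
    have hya : 0 < φ' y := by
      rw [hyd, h0]
      have := hpos x hx.1
      have := hx.1
      apply div_pos <;> linarith
    have hy0 : 0 < y := hy.1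
    have hN : 0 < |M| + 1 := by positivity
    have h1 := hpos 1 one_pos
    have hxp : 0 < x := hx.1
    set δ := (y / x * φ' y) / ((|M| + 1) * φ 1) with hδ
    have hδp : 0 < δ := by positivity
    have hm : 0 < min δ (φ' y) := lt_min hδp hya
    obtain ⟨z, hz, hzm⟩ := exists_hasDerivWithinAt_eq_of_lt_of_gt (f := φ) (f' := φ')
      (a := y) (b := x) (m := min δ (φ' y) / 2) hy.2.le
      (fun z hz => (hdiff z ⟨hy0.trans_le hz.1, hz.2.trans_lt hx.2⟩).hasDerivWithinAt)
      (by have := min_le_right δ (φ' y); linarith) (by rw [hx0]; linarith)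
    have hz0 : 0 < z := hy0.trans hz.1
    have hzp : 0 < φ' z := by rw [hzm]; linarith
    have ht : y / z ∈ Set.Ioo (0:ℝ) 1 := ⟨by positivity, (div_lt_one hz0).2 hz.1⟩
    have hb := hbound (y / z) ht z ⟨hz0, hz.2.trans hx.2⟩
    have hpt := hpos _ ht.1
    rw [div_mul_cancel₀ _ hz0.ne', div_le_iff₀ (by positivity)] at hb
    have e1 : y / x * φ' y ≤ y / z * φ' y := by
      have := hz.2.le
      gcongr
    have e2 : M * (φ (y / z) * φ' z) ≤ (|M| + 1) * (φ 1 * φ' z) := by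
      have a1 : M ≤ |M| + 1 := by linarith [le_abs_self M]
      have a2 : φ (y / z) ≤ φ 1 := hmono.monotone ht.2.le
      gcongr
    have e3 : δ ≤ φ' z := by
      rw [hδ, div_le_iff₀ (by positivity)]
      nlinarith
    have := min_le_left δ (φ' y)
    linarith
  have key : ∀ t ∈ Set.Ioo (0:ℝ) 1, ∀ x ∈ Set.Icc (0:ℝ) cΩ,
      φ (t * x) ≤ M * φ t * φ x := by
    intro t ht x hx
    have hg : MonotoneOn (fun x => M * φ t * φ x - φ (t * x)) (Set.Icc 0 cΩ) := by
      apply monotoneOn_of_hasDerivWithinAt_nonneg (f' := fun x => M * φ t * φ' x - φ' (t * x) * t)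
        (convex_Icc _ _)
      · fun_prop
      · intro z hz
        rw [interior_Icc] at hz
        have htz : t * z ∈ Set.Ioo (0:ℝ) cΩ :=
          ⟨mul_pos ht.1 hz.1, by nlinarith [ht.2, hz.1, hz.2]⟩
        have d1 := (hdiff z hz).const_mul (M * φ t)
        have d2 : HasDerivAt (fun x => t * x) t z := by
          simpa using (hasDerivAt_id z).const_mul t
        have d3 := HasDerivAt.comp z (hdiff _ htz) d2
        exact (d1.sub d3).hasDerivWithinAt
      · intro z hz
        rw [interior_Icc] at hz
        have hb := hbound t ht z hz
        rw [div_le_iff₀ (mul_pos (hpos t ht.1) (hd z hz))] at hb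
        show 0 ≤ M * φ t * φ' z - φ' (t * z) * t
        linarith
    have := hg ⟨le_rfl, hcΩ.le⟩ hx hx.1
    simp only [mul_zero, h0, sub_zero] at this
    linarith
  intro t ht x hx
  rcases ht.1.eq_or_lt with rfl | htp
  · simp [h0]
  · have hcl : t ∈ closure (Set.Ioo (0:ℝ) 1) := by
      rw [closure_Ioo (by norm_num)]
      exact ht
    have hc : IsClosed {t : ℝ | φ (t * x) ≤ M * φ t * φ x} :=
      isClosed_le (by fun_prop) (by fun_prop)
    exact closure_minimal (fun s hs => key s hs x hx) hc hcl
end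

section
/- The function x ↦ (e^x − x − 1)/x² is strictly increasing on (0,∞). Consequently, φ(x) := e^x − x − 1 satisfies φ(tx) ≤ t² φ(x) for all t ∈ [0,1] and x ≥ 0. -/
open Set Real

lemma aux_pos (x : ℝ) (hx : 0 < x) : 0 < (x - 2) * Real.exp x + x + 2 := by
  have hd : ∀ y : ℝ, HasDerivAt (fun x : ℝ => (x - 2) * Real.exp x + x + 2)
      ((y - 1) * Real.exp y + 1) y := by
    intro y
    have h := ((((hasDerivAt_id y).sub_const 2).mul (Real.hasDerivAt_exp y)).add
      (hasDerivAt_id y)).add_const 2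
    refine HasDerivAt.congr_deriv (f := fun x : ℝ => (x - 2) * Real.exp x + x + 2) h ?_
    simp only [id]
    ring
  have hm : StrictMonoOn (fun x : ℝ => (x - 2) * Real.exp x + x + 2) (Set.Ici 0) := by
    apply strictMonoOn_of_deriv_pos (convex_Ici 0)
    · exact fun y _ => (hd y).continuousAt.continuousWithinAt
    · intro y hy
      rw [interior_Ici] at hy
      have hy0 : 0 < y := hy
      rw [(hd y).deriv]
      have h1 := Real.add_one_lt_exp (x := -y) (by linarith)
      have h2 : Real.exp (-y) * Real.exp y = 1 := by rw [← Real.exp_add]; simp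
      nlinarith [Real.exp_pos y]
  have h := hm (Set.mem_Ici.2 le_rfl) (Set.mem_Ici.2 hx.le) hx
  simpa using h

/-- Example (a3). `x ↦ (e^x - x - 1)/x²` is strictly increasing
on `(0,∞)`; consequently `φ(x) = e^x - x - 1` satisfies `φ(tx) ≤ t² φ(x)` for
all `t ∈ [0,1]`, `x ≥ 0`. -/
theorem H1_for_exp_minus_linear :
    StrictMonoOn (fun x : ℝ => (Real.exp x - x - 1) / x ^ 2) (Set.Ioi 0) ∧
    ∀ t ∈ Set.Icc (0:ℝ) 1, ∀ x ≥ (0:ℝ),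
      Real.exp (t * x) - t * x - 1 ≤ t ^ 2 * (Real.exp x - x - 1) := by
  have hm : StrictMonoOn (fun x : ℝ => (Real.exp x - x - 1) / x ^ 2) (Set.Ioi 0) := by
    have hd : ∀ y : ℝ, 0 < y → HasDerivAt (fun x : ℝ => (Real.exp x - x - 1) / x ^ 2)
        (((Real.exp y - 1) * y ^ 2 - (Real.exp y - y - 1) * (2 * y)) / (y ^ 2) ^ 2) y := by
      intro y hy
      have h := (((Real.hasDerivAt_exp y).sub (hasDerivAt_id y)).sub_const 1).div
        (hasDerivAt_pow 2 y) (by positivity)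
      refine HasDerivAt.congr_deriv (f := fun x : ℝ => (Real.exp x - x - 1) / x ^ 2) h ?_
      simp
    apply strictMonoOn_of_deriv_pos (convex_Ioi 0)
    · exact fun y hy => (hd y hy).continuousAt.continuousWithinAt
    · intro y hy
      rw [interior_Ioi] at hy
      have hy0 : 0 < y := hy
      rw [(hd y hy0).deriv]
      apply div_pos _ (by positivity)
      have := mul_pos hy0 (aux_pos y hy0)
      linarith
  refine ⟨hm, ?_⟩
  rintro t ⟨ht0, ht1⟩ x hx
  rcases eq_or_lt_of_le ht0 with rfl | ht
  · simp
  rcases eq_or_lt_of_le hx with rfl | hx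
  · simp
  have htx : 0 < t * x := mul_pos ht hx
  have h := hm.monotoneOn (Set.mem_Ioi.2 htx) (Set.mem_Ioi.2 hx) (by nlinarith)
  rw [div_le_div_iff₀ (by positivity) (by positivity)] at h
  have hx2 : 0 < x ^ 2 := by positivity
  refine le_of_mul_le_mul_right ?_ hx2
  linarith
end

section
/- Let p₁ > p₂ > 0 and define φ(x) := x^{p₁}/(1 + x^{p₂}) for x ≥ 0, and let c_Ω > 0. Then φ(tx) ≤ 2(1 + c_Ω^{p₂}) φ(t) φ(x) for all t ∈ [0,1] and all x ∈ [0,c_Ω]; that is, φ satisfies hypothesis H2 with t₂ = 1 and M = 2(1 + c_Ω^{p₂}). -/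
open Set

/-- Example (a4). For `p₁ > p₂ > 0`, `φ(x) = x^{p₁}/(1+x^{p₂})`
satisfies `φ(tx) ≤ 2(1 + c_Ω^{p₂}) φ(t) φ(x)` for all `t ∈ [0,1]` and
`x ∈ [0,c_Ω]`; i.e. H2 holds with `t₂ = 1`, `M = 2(1 + c_Ω^{p₂})`. -/
theorem H2_for_rational_power
    (p₁ p₂ : ℝ) (hp₂ : 0 < p₂) (hp : p₂ < p₁)
    (cΩ : ℝ) (hcΩ : 0 < cΩ)
    (φ : ℝ → ℝ) (hφ : ∀ x ≥ (0:ℝ), φ x = x ^ p₁ / (1 + x ^ p₂)) :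
    ∀ t ∈ Set.Icc (0:ℝ) 1, ∀ x ∈ Set.Icc (0:ℝ) cΩ,
      φ (t * x) ≤ 2 * (1 + cΩ ^ p₂) * φ t * φ x := by
  rintro t ⟨ht0, ht1⟩ x ⟨hx0, hxc⟩
  rw [hφ _ (mul_nonneg ht0 hx0), hφ t ht0, hφ x hx0,
    Real.mul_rpow ht0 hx0, Real.mul_rpow ht0 hx0]
  have ha0 : 0 ≤ t ^ p₂ := Real.rpow_nonneg ht0 _
  have hb0 : 0 ≤ x ^ p₂ := Real.rpow_nonneg hx0 _
  have hA0 : 0 ≤ t ^ p₁ := Real.rpow_nonneg ht0 _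
  have hB0 : 0 ≤ x ^ p₁ := Real.rpow_nonneg hx0 _
  have ha1 : t ^ p₂ ≤ 1 := Real.rpow_le_one ht0 ht1 hp₂.le
  have hbc : x ^ p₂ ≤ cΩ ^ p₂ := Real.rpow_le_rpow hx0 hxc hp₂.le
  generalize t ^ p₂ = a at *
  generalize x ^ p₂ = b at *
  generalize t ^ p₁ = A at *
  generalize x ^ p₁ = B at *
  generalize cΩ ^ p₂ = c at *
  have hAB : 0 ≤ A * B := mul_nonneg hA0 hB0
  have h1 : A * B / (1 + a * b) ≤ A * B :=
    div_le_self hAB (by nlinarith [mul_nonneg ha0 hb0])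
  have h2 : (1 + a) * (1 + b) ≤ 2 * (1 + c) :=
    mul_le_mul (by linarith) (by linarith) (by linarith) (by norm_num)
  have h3 : 2 * (1 + c) * (A / (1 + a)) * (B / (1 + b))
      = (A * B) * (2 * (1 + c)) / ((1 + a) * (1 + b)) := by
    field_simp
  rw [h3]
  refine h1.trans ?_
  rw [le_div_iff₀ (by positivity)]
  exact mul_le_mul_of_nonneg_left h2 hAB
end

section
/- Define φ(x) := x(|ln x| + 1) for x > 0 and φ(0) := 0. Then φ(tx) ≤ φ(t) φ(x) for all t, x ≥ 0; in particular φ satisfies hypothesis H2 with M = 1 and any t₂ > 0. Moreover, for every p ∈ (0,1) there exists t₁ > 0 such that φ(tx) ≤ t^p φ(x) for all t ∈ [0,t₁] and all x ≥ 0, so φ also satisfies hypothesis H1 with ψ(t) = t^p. -/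
open Set Real

/-- Example (b). `φ(x) = x(|ln x| + 1)` for `x > 0`, `φ(0) = 0`,
satisfies `φ(tx) ≤ φ(t)φ(x)` for all `t, x ≥ 0` (H2 with `M = 1`, any
`t₂ > 0`), and for every `p ∈ (0,1)` there is `t₁ > 0` with
`φ(tx) ≤ t^p φ(x)` for `t ∈ [0,t₁]`, `x ≥ 0` (H1 with `ψ(t) = t^p`). -/
theorem H1_H2_for_x_log
    (φ : ℝ → ℝ) (hφ0 : φ 0 = 0)
    (hφ : ∀ x > (0:ℝ), φ x = x * (|Real.log x| + 1)) :
    (∀ t ≥ (0:ℝ), ∀ x ≥ (0:ℝ), φ (t * x) ≤ φ t * φ x) ∧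
    ∀ p ∈ Set.Ioo (0:ℝ) 1, ∃ t₁ > (0:ℝ),
      ∀ t ∈ Set.Icc (0:ℝ) t₁, ∀ x ≥ (0:ℝ), φ (t * x) ≤ t ^ p * φ x := by
  have hnn : ∀ x ≥ (0:ℝ), 0 ≤ φ x := by
    intro x hx
    rcases hx.lt_or_eq with h | h
    · rw [hφ x h]; positivity
    · rw [← h, hφ0]
  have key : ∀ t ≥ (0:ℝ), ∀ x ≥ (0:ℝ), φ (t * x) ≤ φ t * φ x := by
    intro t ht x hx
    rcases ht.lt_or_eq with ht | ht
    · rcases hx.lt_or_eq with hx | hx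
      · rw [hφ _ (mul_pos ht hx), hφ t ht, hφ x hx, Real.log_mul ht.ne' hx.ne']
        have h1 := abs_add_le (Real.log t) (Real.log x)
        have h2 : 0 ≤ |Real.log t| * |Real.log x| := by positivity
        have h3 : |Real.log t + Real.log x| + 1 ≤ (|Real.log t| + 1) * (|Real.log x| + 1) := by
          nlinarith
        calc t * x * (|Real.log t + Real.log x| + 1)
            ≤ t * x * ((|Real.log t| + 1) * (|Real.log x| + 1)) :=
              mul_le_mul_of_nonneg_left h3 (mul_pos ht hx).le
          _ = _ := by ring
      · simp [← hx, hφ0]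
    · simp [← ht, hφ0]
  refine ⟨key, ?_⟩
  rintro p ⟨hp0, hp1⟩
  have hr : 0 < 1 - p := by linarith
  have L1 := tendsto_log_mul_rpow_nhdsGT_zero hr
  have L2 : Filter.Tendsto (fun t : ℝ => t ^ (1 - p)) (nhdsWithin 0 (Set.Ioi 0)) (nhds 0) := by
    have h := (Real.continuousAt_rpow_const 0 (1 - p) (Or.inr hr.le)).tendsto
    rw [Real.zero_rpow hr.ne'] at h
    exact h.mono_left nhdsWithin_le_nhds
  have L3 := L1.abs.add L2
  have E := L3.eventually (gt_mem_nhds (show |(0:ℝ)| + 0 < 1 by simp))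
  obtain ⟨u, hu, hE⟩ := mem_nhdsGT_iff_exists_Ioc_subset.1 E
  refine ⟨u, hu, ?_⟩
  rintro t ⟨ht0, htu⟩ x hx
  rcases ht0.lt_or_eq with ht | ht
  · refine (key t ht0 x hx).trans (mul_le_mul_of_nonneg_right ?_ (hnn x hx))
    have h : |Real.log t * t ^ (1 - p)| + t ^ (1 - p) < 1 := hE ⟨ht, htu⟩
    have hpos := Real.rpow_pos_of_pos ht (1 - p)
    have hpos2 := Real.rpow_pos_of_pos ht p
    rw [abs_mul, abs_of_pos hpos] at h
    have e : t = t ^ p * t ^ (1 - p) := by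
      rw [← Real.rpow_add ht]; simp
    rw [hφ t ht]
    calc t * (|Real.log t| + 1) = t ^ p * t ^ (1 - p) * (|Real.log t| + 1) := by rw [← e]
      _ = t ^ p * (|Real.log t| * t ^ (1 - p) + t ^ (1 - p)) := by ring
      _ ≤ t ^ p * 1 := mul_le_mul_of_nonneg_left h.le hpos2.le
      _ = t ^ p := mul_one _
  · simp [← ht, hφ0, Real.zero_rpow hp0.ne']
end

section
/- Let p > 0 and define φ(x) := (ln(x + 1))^p for x ≥ 0. Then for every t > 0, lim_{x→∞} φ(tx)/φ(x) = lim_{x→∞} (ln(tx+1))^p/(ln(x+1))^p = 1. Consequently, there is no continuous increasing function ψ on an interval [0,t₁] with ψ(0) = 0 satisfying φ(tx) ≤ ψ(t)φ(x) for all t ∈ [0,t₁] and x ≥ 0; that is, φ does not satisfy hypothesis H1. -/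
open Set Real Filter

/-- Example (d). For `φ(x) = (ln(x+1))^p` with `p > 0`,
`lim_{x→∞} φ(tx)/φ(x) = 1` for every `t > 0`, and consequently there is no
continuous increasing `ψ` on some `[0,t₁]` with `ψ(0) = 0` and
`φ(tx) ≤ ψ(t)φ(x)` for all `t ∈ [0,t₁]`, `x ≥ 0`; i.e. `φ` fails H1. -/
theorem not_H1_for_log_power
    (p : ℝ) (hp : 0 < p)
    (φ : ℝ → ℝ) (hφ : ∀ x ≥ (0:ℝ), φ x = Real.log (x + 1) ^ p) :
    (∀ t > (0:ℝ),
      Tendsto (fun x : ℝ => Real.log (t * x + 1) ^ p / Real.log (x + 1) ^ p)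
        atTop (nhds 1)) ∧
    ¬ ∃ t₁ > (0:ℝ), ∃ ψ : ℝ → ℝ,
        ContinuousOn ψ (Set.Icc 0 t₁) ∧ StrictMonoOn ψ (Set.Icc 0 t₁) ∧ ψ 0 = 0 ∧
        ∀ t ∈ Set.Icc (0:ℝ) t₁, ∀ x ≥ (0:ℝ), φ (t * x) ≤ ψ t * φ x := by
  have key : ∀ t > (0:ℝ),
      Tendsto (fun x : ℝ => Real.log (t * x + 1) ^ p / Real.log (x + 1) ^ p)
        atTop (nhds 1) := by
    intro t ht
    have hx1 : Tendsto (fun x : ℝ => x + 1) atTop atTop :=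
      tendsto_atTop_add_const_right _ _ tendsto_id
    have hlog : Tendsto (fun x : ℝ => Real.log (x + 1)) atTop atTop :=
      Real.tendsto_log_atTop.comp hx1
    have h1 : Tendsto (fun x : ℝ => t + (1 - t) / (x + 1)) atTop (nhds t) := by
      simpa using (tendsto_const_nhds (x := t)).add (hx1.const_div_atTop (1 - t))
    have h2 : Tendsto (fun x : ℝ => Real.log (t + (1 - t) / (x + 1))) atTop
        (nhds (Real.log t)) := h1.log ht.ne'
    have h3 : Tendsto (fun x : ℝ => 1 + Real.log (t + (1 - t) / (x + 1)) / Real.log (x + 1))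
        atTop (nhds 1) := by
      simpa using (tendsto_const_nhds (x := (1:ℝ))).add (h2.div_atTop hlog)
    have h4 := h3.rpow_const (p := p) (Or.inl one_ne_zero)
    rw [Real.one_rpow] at h4
    refine h4.congr' ?_
    filter_upwards [eventually_gt_atTop (0:ℝ)] with x hx
    have hl : 0 < Real.log (x + 1) := Real.log_pos (by linarith)
    have htx : 0 < t * x := mul_pos ht hx
    have e : t + (1 - t) / (x + 1) = (t * x + 1) / (x + 1) := by
      field_simp
      ring
    rw [← Real.div_rpow (Real.log_nonneg (by linarith)) hl.le, e,
      Real.log_div (by positivity) (by positivity)]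
    congr 1
    field_simp
    ring
  refine ⟨key, ?_⟩
  rintro ⟨t₁, ht₁, ψ, hc, -, h0, h⟩
  have hge : ∀ t ∈ Set.Ioc (0:ℝ) t₁, 1 ≤ ψ t := by
    intro t ht
    refine le_of_tendsto (key t ht.1) ?_
    filter_upwards [eventually_gt_atTop (0:ℝ)] with x hx
    have hl : 0 < Real.log (x + 1) := Real.log_pos (by linarith)
    have := h t ⟨ht.1.le, ht.2⟩ x hx.le
    rw [hφ _ (mul_pos ht.1 hx).le, hφ _ hx.le] at this
    rwa [div_le_iff₀ (Real.rpow_pos_of_pos hl p)]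
  have hc0 : Tendsto ψ (nhdsWithin 0 (Set.Ioc 0 t₁)) (nhds (ψ 0)) :=
    (hc 0 ⟨le_rfl, ht₁.le⟩).mono Set.Ioc_subset_Icc_self
  have hev : ∀ᶠ t in nhdsWithin 0 (Set.Ioc 0 t₁), 1 ≤ ψ t := by
    filter_upwards [self_mem_nhdsWithin] with t ht using hge t ht
  rw [nhdsWithin_Ioc_eq_nhdsGT ht₁] at hc0 hev
  have := ge_of_tendsto hc0 hev
  linarith
end
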